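/- Let K = Q(√D) with D ∈ {−1, −2, −3, −7, −11} and ring of integers O_K, and let s, t, d ∈ O_K with s, t, d all nonzero and s² ≠ t². Then there do not exist a, b, c ∈ O_K such that d·s² = a³(a+2b)c² and d·t² = b³(b+2a)c². -/

import Mathlib

open NumberField

namespace Aux
set_option linter.unusedSectionVars false
open WeierstrassCurve

/-- The curve `y² = x (x - n) (x - 4 n)`. -/
structure IsE {F : Type*} [Field F] (W : WeierstrassCurve.Affine F) (n : F) : Prop where
  a1 : W.a₁ = 0
  a2 : W.a₂ = -5 * n
  a3 : W.a₃ = 0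
  a4 : W.a₄ = 4 * n ^ 2
  a6 : W.a₆ = 0
  n0 : n ≠ 0

section field
variable {F : Type*} [Field F] [CharZero F] {W : WeierstrassCurve.Affine F} {n : F}

theorem IsE.eq (hW : IsE W n) {x y : F} :
    W.Equation x y ↔ y ^ 2 = x * (x - n) * (x - 4 * n) := by
  rw [Affine.equation_iff, hW.a1, hW.a2, hW.a3, hW.a4, hW.a6]
  constructor <;> intro h <;> linear_combination h

theorem IsE.ns (hW : IsE W n) {x y : F} (h : y ^ 2 = x * (x - n) * (x - 4 * n)) :
    W.Nonsingular x y := by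
  have hD : W.Δ = 2304 * n ^ 6 := by
    simp only [WeierstrassCurve.Δ, WeierstrassCurve.b₂, WeierstrassCurve.b₄, WeierstrassCurve.b₆,
      WeierstrassCurve.b₈, hW.a1, hW.a2, hW.a3, hW.a4, hW.a6]
    ring
  rw [← Affine.equation_iff_nonsingular_of_Δ_ne_zero, hW.eq]
  · exact h
  · rw [hD]
    exact mul_ne_zero (by norm_num) (pow_ne_zero _ hW.n0)

theorem IsE.negY (hW : IsE W n) (x y : F) : W.negY x y = -y := by
  simp [Affine.negY, hW.a1, hW.a3]

variable [DecidableEq F]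

theorem IsE.add (hW : IsE W n) {x₁ y₁ x₂ y₂ : F} (h₁ : W.Nonsingular x₁ y₁)
    (h₂ : W.Nonsingular x₂ y₂) (hx : x₁ ≠ x₂) :
    ∃ x₃ y₃, ∃ h₃ : W.Nonsingular x₃ y₃,
      Affine.Point.some x₁ y₁ h₁ + Affine.Point.some x₂ y₂ h₂ = Affine.Point.some x₃ y₃ h₃ ∧
      IsSquare (x₁ * x₂ * x₃) ∧ IsSquare ((x₁ - n) * (x₂ - n) * (x₃ - n)) ∧
      IsSquare ((x₁ - 4 * n) * (x₂ - 4 * n) * (x₃ - 4 * n)) := by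
  refine ⟨_, _, _, Affine.Point.add_of_X_ne hx, ?_⟩
  have e1 := hW.eq.1 h₁.1
  have e2 := hW.eq.1 h₂.1
  rw [Affine.slope_of_X_ne hx]
  have hx' := sub_ne_zero.2 hx
  obtain ⟨l, hl⟩ : ∃ l, l = (y₁ - y₂) / (x₁ - x₂) := ⟨_, rfl⟩
  rw [← hl]
  have hy : y₂ = y₁ - l * (x₁ - x₂) := by rw [hl]; field_simp; ring
  have hg : 2 * y₁ * l - l ^ 2 * (x₁ - x₂) = x₁ ^ 2 + x₁ * x₂ + x₂ ^ 2 - 5 * n * (x₁ + x₂)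
      + 4 * n ^ 2 := by
    apply mul_left_cancel₀ hx'
    rw [hy] at e2
    linear_combination e1 - e2
  simp only [Affine.addX, hW.a1, hW.a2]
  refine ⟨⟨y₁ - l * x₁, ?_⟩, ⟨y₁ + l * (n - x₁), ?_⟩, ⟨y₁ + l * (4 * n - x₁), ?_⟩⟩
  · linear_combination -e1 - (-x₁) * hg
  · linear_combination -e1 - (n - x₁) * hg
  · linear_combination -e1 - (4 * n - x₁) * hg

theorem IsE.dbl (hW : IsE W n) {x y : F} (h : W.Nonsingular x y) (hy : y ≠ 0) :
    ∃ x₃ y₃, ∃ h₃ : W.Nonsingular x₃ y₃,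
      (2 : ℕ) • Affine.Point.some x y h = Affine.Point.some x₃ y₃ h₃ ∧
      x₃ * (2 * y) ^ 2 = (x ^ 2 - 4 * n ^ 2) ^ 2 ∧
      (x₃ - n) * (2 * y) ^ 2 = (x ^ 2 - 2 * n * x + 4 * n ^ 2) ^ 2 ∧
      (x₃ - 4 * n) * (2 * y) ^ 2 = (x ^ 2 - 8 * n * x + 4 * n ^ 2) ^ 2 ∧
      y₃ * (2 * y) = - ((3 * x ^ 2 - 10 * n * x + 4 * n ^ 2) * (x₃ - x) + 2 * y ^ 2) := by
  have hy' : y ≠ W.negY x y := by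
    rw [hW.negY]; intro h'; apply hy
    have : 2 * y = 0 := by linear_combination h'
    simpa using this
  refine ⟨_, _, _, (two_nsmul _).trans (Affine.Point.add_self_of_Y_ne hy'), ?_⟩
  have e1 := hW.eq.1 h.1
  rw [Affine.slope_of_Y_ne rfl hy']
  simp only [hW.negY, Affine.addX, Affine.addY, Affine.negAddY, hW.a1, hW.a2, hW.a4]
  have h2 : y - -y ≠ 0 := by
    have : y - -y = 2 * y := by ring
    rw [this]; simpa using hy
  obtain ⟨l, hl⟩ : ∃ l, l = (3 * x ^ 2 + 2 * (-5 * n) * x + 4 * n ^ 2 - 0 * y) / (y - -y) :=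
    ⟨_, rfl⟩
  rw [← hl]
  have hl2 : l * (2 * y) = 3 * x ^ 2 - 10 * n * x + 4 * n ^ 2 := by
    rw [hl]; field_simp; ring
  refine ⟨?_, ?_, ?_, ?_⟩
  · linear_combination (l * (2 * y) + (3 * x ^ 2 - 10 * n * x + 4 * n ^ 2)) * hl2 +
      (20 * n - 8 * x) * e1
  · linear_combination (l * (2 * y) + (3 * x ^ 2 - 10 * n * x + 4 * n ^ 2)) * hl2 +
      (16 * n - 8 * x) * e1
  · linear_combination (l * (2 * y) + (3 * x ^ 2 - 10 * n * x + 4 * n ^ 2)) * hl2 +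
      (4 * n - 8 * x) * e1
  · linear_combination -(l ^ 2 + 0 * l - -5 * n - x - x - x) * hl2

theorem IsE.dbl_zero (hW : IsE W n) {x y : F} (h : W.Nonsingular x y) (hy : y = 0) :
    (2 : ℕ) • Affine.Point.some x y h = 0 := by
  rw [two_nsmul]
  apply Affine.Point.add_self_of_Y_eq
  rw [hW.negY, hy, neg_zero]

theorem isSquare_of_mul {a b c : F} (h : a * b ^ 2 = c ^ 2) (hb : b ≠ 0) : IsSquare a :=
  ⟨c / b, by field_simp; exact h⟩

theorem IsE.dbl_sq (hW : IsE W n) {P : W.Point} {x y : F} {h : W.Nonsingular x y}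
    (hP : (2 : ℕ) • P = Affine.Point.some x y h) :
    IsSquare x ∧ IsSquare (x - n) ∧ IsSquare (x - 4 * n) := by
  rcases P with _ | ⟨x₁, y₁, h₁⟩
  · rw [← Affine.Point.zero_def, smul_zero] at hP
    exact absurd hP.symm (Affine.Point.some_ne_zero h)
  · by_cases hy : y₁ = 0
    · rw [hW.dbl_zero h₁ hy] at hP
      exact absurd hP.symm (Affine.Point.some_ne_zero h)
    · obtain ⟨x₃, y₃, h₃, e, a, b, c, -⟩ := hW.dbl h₁ hy
      rw [e] at hP
      obtain ⟨rfl, rfl⟩ := (Affine.Point.some.injEq _ _ _ _ _ _).mp hP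
      have h2 : 2 * y₁ ≠ 0 := mul_ne_zero two_ne_zero hy
      exact ⟨isSquare_of_mul a h2, isSquare_of_mul b h2, isSquare_of_mul c h2⟩

theorem IsE.halve (hW : IsE W n) {x y : F} (h : W.Nonsingular x y)
    (h1 : IsSquare x) (h2 : IsSquare (x - n)) (h3 : IsSquare (x - 4 * n)) :
    ∃ Q : W.Point, (2 : ℕ) • Q = Affine.Point.some x y h := by
  obtain ⟨u, hu⟩ := h1
  obtain ⟨v, hv⟩ := h2
  obtain ⟨w', hw'⟩ := h3
  have e1 := hW.eq.1 h.1
  obtain ⟨w, hw, hy⟩ : ∃ w, x - 4 * n = w * w ∧ y = u * v * w := by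
    have : (y - u * v * w') * (y + u * v * w') = 0 := by
      have : y ^ 2 = (u * u) * (v * v) * (w' * w') := by rw [← hu, ← hv, ← hw']; exact e1
      linear_combination this
    rcases mul_eq_zero.1 this with h | h
    · exact ⟨w', hw', by linear_combination h⟩
    · exact ⟨-w', by rw [hw']; ring, by linear_combination h⟩
  have hn := hW.n0
  have huv : u + v ≠ 0 := fun h => hn (by linear_combination hu - hv + (u - v) * h)
  have huw : u + w ≠ 0 := fun h => hn (by
    have : 4 * n = 0 := by linear_combination hu - hw + (u - w) * h
    simpa using this)
  have hvw : v + w ≠ 0 := fun h => hn (by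
    have : 3 * n = 0 := by linear_combination hv - hw + (v - w) * h
    simpa using this)
  have hnn : n = u * u - v * v := by linear_combination hu - hv
  have hn4 : 4 * n = u * u - w * w := by linear_combination hu - hw
  set X := (u + v) * (u + w) with hX
  set Y := (u + v) * (u + w) * (v + w) with hY
  have hXY : Y ^ 2 = X * (X - n) * (X - 4 * n) := by
    rw [hn4, hnn, hX, hY]; ring
  have hY0 : Y ≠ 0 := mul_ne_zero (mul_ne_zero huv huw) hvw
  obtain ⟨x₃, y₃, h₃, e, a, b, c, d⟩ := hW.dbl (hW.ns hXY) hY0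
  refine ⟨_, e.trans ?_⟩
  have h2Y : 2 * Y ≠ 0 := mul_ne_zero two_ne_zero hY0
  have hx3 : x₃ = x := by
    apply mul_right_cancel₀ (pow_ne_zero 2 h2Y)
    rw [a, hu, hY, hX]
    have : 4 * n ^ 2 = (u * u - v * v) * (u * u - w * w) := by rw [← hn4, ← hnn]; ring
    rw [this]; ring
  have hy3 : y₃ = y := by
    apply mul_right_cancel₀ h2Y
    rw [d, hx3, hy, hu]
    have t1 : 4 * n ^ 2 = (u * u - v * v) * (u * u - w * w) := by rw [← hn4, ← hnn]; ring
    have t2 : 10 * n = 2 * (u * u - v * v + (u * u - w * w)) := by rw [← hn4, ← hnn]; ring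
    rw [t1, t2, hY, hX]; ring
  subst hx3 hy3
  rfl

/-- Coset lemma. -/
theorem IsE.coset (hW : IsE W n) {x y : F} (h : W.Nonsingular x y) {t s : F}
    (hT : W.Nonsingular t s) (hT4 : (4 : ℕ) • Affine.Point.some t s hT = 0)
    (h1 : IsSquare (x * t)) (h2 : IsSquare ((x - n) * (t - n)))
    (h3 : IsSquare ((x - 4 * n) * (t - 4 * n))) :
    ∃ Q S : W.Point, Affine.Point.some x y h = (2 : ℕ) • Q + S ∧ (4 : ℕ) • S = 0 := by
  by_cases hP : (4 : ℕ) • Affine.Point.some x y h = 0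
  · exact ⟨0, _, by rw [smul_zero, zero_add], hP⟩
  have hxt : x ≠ t := by
    intro hx
    rcases (Affine.Point.X_eq_iff (h₁ := h) (h₂ := hT)).1 hx with h' | h'
    · exact hP (h' ▸ hT4)
    · apply hP; rw [h', smul_neg, hT4, neg_zero]
  have hy : y ≠ 0 := fun hy => hP (by
    rw [show (4 : ℕ) = 2 * 2 from rfl, mul_nsmul, hW.dbl_zero h hy, smul_zero])
  obtain ⟨x₃, y₃, h₃, e, a, b, c⟩ := hW.add h hT hxt
  have hy3 : y₃ ≠ 0 := by
    intro hy3
    apply hP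
    have := congrArg (fun P => (2 * 2 : ℕ) • P) e
    simp only [smul_add] at this
    rw [show (2 * 2 : ℕ) = 4 from rfl, hT4, add_zero] at this
    rw [this, show (4 : ℕ) = 2 * 2 from rfl, mul_nsmul, hW.dbl_zero h₃ hy3, smul_zero]
  have e1 := hW.eq.1 h.1
  have e3 := hW.eq.1 h₃.1
  have hx : x * (x - n) * (x - 4 * n) ≠ 0 := by rw [← e1]; exact pow_ne_zero _ hy
  have hx3 : x₃ * (x₃ - n) * (x₃ - 4 * n) ≠ 0 := by rw [← e3]; exact pow_ne_zero _ hy3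
  simp only [ne_eq, mul_eq_zero, not_or] at hx hx3
  obtain ⟨⟨k1, k2⟩, k3⟩ := hx
  obtain ⟨⟨m1, m2⟩, m3⟩ := hx3
  have key : ∀ {p q r : F}, p ≠ 0 → q ≠ 0 → IsSquare (p * q) → IsSquare (p * q * r) →
      IsSquare r := by
    rintro p q r hp hq ⟨u, hu⟩ ⟨v, hv⟩
    refine isSquare_of_mul (b := u) (c := v) ?_ ?_
    · linear_combination hv - r * hu
    · rintro rfl; simp at hu; tauto
  have third : ∀ {p q r y : F}, p ≠ 0 → q ≠ 0 → y ^ 2 = p * q * r → IsSquare p → IsSquare q →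
      IsSquare r := by
    rintro p q r y hp hq hh ⟨u, hu⟩ ⟨v, hv⟩
    refine isSquare_of_mul (b := u * v) (c := y) ?_ ?_
    · rw [hh, hu, hv]; ring
    · rintro h0
      rcases mul_eq_zero.1 h0 with rfl | rfl
      · simp at hu; exact hp hu
      · simp at hv; exact hq hv
  have hn := hW.n0
  have hn4 : 4 * n ≠ 0 := mul_ne_zero (by norm_num) hn
  have hn3 : 3 * n ≠ 0 := mul_ne_zero (by norm_num) hn
  have all : IsSquare x₃ ∧ IsSquare (x₃ - n) ∧ IsSquare (x₃ - 4 * n) := by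
    by_cases t1 : t = 0
    · have t2 : t - n ≠ 0 := by rw [t1, zero_sub]; exact neg_ne_zero.2 hn
      have t3 : t - 4 * n ≠ 0 := by rw [t1, zero_sub]; exact neg_ne_zero.2 hn4
      have q2 := key k2 t2 h2 b
      have q3 := key k3 t3 h3 c
      exact ⟨third m2 m3 (by rw [e3]; ring) q2 q3, q2, q3⟩
    by_cases t2 : t - n = 0
    · have t3 : t - 4 * n ≠ 0 := by
        intro h0; apply hn3; linear_combination t2 - h0
      have q1 := key k1 t1 h1 a
      have q3 := key k3 t3 h3 c
      exact ⟨q1, third m1 m3 (by rw [e3]; ring) q1 q3, q3⟩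
    have q1 := key k1 t1 h1 a
    have q2 := key k2 t2 h2 b
    exact ⟨q1, q2, third m1 m2 e3 q1 q2⟩
  obtain ⟨Q, hQ⟩ := hW.halve h₃ all.1 all.2.1 all.2.2
  refine ⟨Q, - Affine.Point.some t s hT, ?_, by rw [smul_neg, hT4, neg_zero]⟩
  rw [hQ, ← e, add_neg_cancel_right]

end field

section rat
variable {W : WeierstrassCurve.Affine ℚ} {n : ℤ}

theorem val_add_of_lt {q r : ℚ} (hq : q ≠ 0) (hr : r = 0 ∨ padicValRat 2 q < padicValRat 2 r) :
    q + r ≠ 0 ∧ padicValRat 2 (q + r) = padicValRat 2 q := by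
  rcases hr with rfl | hr
  · simpa using hq
  by_cases hr0 : r = 0
  · subst hr0; simpa using hq
  have h0 : q + r ≠ 0 := by
    intro h
    have : r = -q := by linear_combination h
    rw [this, padicValRat.neg] at hr
    exact lt_irrefl _ hr
  exact ⟨h0, padicValRat.add_eq_of_lt h0 hq hr0 hr⟩

theorem val_int (m : ℤ) : 0 ≤ padicValRat 2 (m : ℚ) := by
  rw [padicValRat.of_int]; positivity

theorem val_sub_int {x : ℚ} (hx : padicValRat 2 x < 0) (m : ℤ) :
    x - m ≠ 0 ∧ padicValRat 2 (x - m) = padicValRat 2 x := by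
  have h0 : x ≠ 0 := by rintro rfl; simp at hx
  have := val_add_of_lt (q := x) (r := ((-m : ℤ) : ℚ)) h0
    (Or.inr (lt_of_lt_of_le hx (val_int _)))
  simpa [sub_eq_add_neg] using this

theorem val_two : padicValRat 2 (2 : ℚ) = 1 := by
  have := padicValRat.self (p := 2) (by norm_num)
  exact_mod_cast this

theorem val_four : padicValRat 2 (4 : ℚ) = 2 := by
  rw [show (4 : ℚ) = 2 ^ 2 by norm_num, padicValRat.pow, val_two]; norm_num

/-- Valuation bookkeeping in the doubling formula. -/
theorem val_dbl_formula {x y x₃ a b c : ℚ} (ha : a ≠ 0) (hb : b ≠ 0) (hc : c ≠ 0) (hx : x ≠ 0)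
    (h1 : y ^ 2 = x * a * b) (h2 : x₃ * (2 * y) ^ 2 = c ^ 2) :
    padicValRat 2 x₃ + 2 + (padicValRat 2 x + padicValRat 2 a + padicValRat 2 b)
      = 2 * padicValRat 2 c := by
  have h3 : x₃ * 4 * (x * a * b) = c ^ 2 := by rw [← h1, ← h2]; ring
  have hx3 : x₃ ≠ 0 := by
    rintro rfl
    apply hc
    simpa using h3.symm
  have h4 := congrArg (padicValRat 2) h3
  rw [padicValRat.mul (mul_ne_zero hx3 (by norm_num)) (mul_ne_zero (mul_ne_zero hx ha) hb),
    padicValRat.mul hx3 (by norm_num), padicValRat.mul (mul_ne_zero hx ha) hb,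
    padicValRat.mul hx ha, padicValRat.pow, val_four] at h4
  exact_mod_cast h4

theorem val_dbl (hW : IsE W (n : ℚ)) {x y : ℚ} (h : W.Nonsingular x y)
    (hx : padicValRat 2 x < 0) :
    ∃ x₃ y₃, ∃ h₃ : W.Nonsingular x₃ y₃,
      (2 : ℕ) • Affine.Point.some x y h = Affine.Point.some x₃ y₃ h₃ ∧
      padicValRat 2 x₃ = padicValRat 2 x - 2 := by
  have h0 : x ≠ 0 := by rintro rfl; simp at hx
  have e1 := hW.eq.1 h.1
  obtain ⟨a1, a2⟩ := val_sub_int hx n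
  obtain ⟨b1, b2⟩ := val_sub_int hx (4 * n)
  have hx2 : padicValRat 2 (x ^ 2) = 2 * padicValRat 2 x := by
    rw [padicValRat.pow]; norm_num
  obtain ⟨c1, c2⟩ := val_sub_int (x := x ^ 2) (by omega) (4 * n ^ 2)
  push_cast at b1 b2 c1 c2
  have hy : y ≠ 0 := by
    rintro rfl
    have : x * (x - n) * (x - 4 * n) = 0 := by rw [← e1]; norm_num
    simp only [mul_eq_zero] at this
    tauto
  obtain ⟨x₃, y₃, h₃, e, a, -⟩ := hW.dbl h hy
  refine ⟨x₃, y₃, h₃, e, ?_⟩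
  have := val_dbl_formula a1 b1 c1 h0 e1 a
  omega

theorem mod_fact (hn : n ∈ ({-1, 1, 2, 3, 7, 11} : Set ℤ)) {A B C e : ℤ} (he : e % 2 = 1)
    (h1 : A ^ 2 - n * e ^ 2 = B ^ 2) (h2 : A ^ 2 - 4 * n * e ^ 2 = C ^ 2) :
    n % 2 = 1 ∧ (4 : ℤ) ∣ A := by
  have key : ∀ a b c f : ZMod 16, ∀ m ∈ [(-1 : ZMod 16), 1, 2, 3, 7, 11],
      f * 8 = 8 → a ^ 2 - m * f ^ 2 = b ^ 2 → a ^ 2 - 4 * m * f ^ 2 = c ^ 2 →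
      m * 8 = 8 ∧ a * 4 = 0 := by
    have sq : ∀ a : ZMod 16, a ^ 2 ∈ [(0 : ZMod 16), 1, 4, 9] ∧ (a ^ 2 = 0 → a * 4 = 0) := by decide
    have sq1 : ∀ a : ZMod 16, a * 8 = 8 → a ^ 2 ∈ [(1 : ZMod 16), 9] := by decide
    have main : ∀ m ∈ [(-1 : ZMod 16), 1, 2, 3, 7, 11], ∀ a ∈ [(0 : ZMod 16), 1, 4, 9],
      ∀ b ∈ [(0 : ZMod 16), 1, 4, 9], ∀ c ∈ [(0 : ZMod 16), 1, 4, 9], ∀ f ∈ [(1 : ZMod 16), 9],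
      a - m * f = b → a - 4 * m * f = c → m * 8 = 8 ∧ a = 0 := by decide
    intro a b c f m hm hf h1 h2
    have := main m hm _ (sq a).1 _ (sq b).1 _ (sq c).1 _ (sq1 f hf) h1 h2
    exact ⟨this.1, (sq a).2 this.2⟩
  have := key A B C e n (by
      rcases hn with rfl | rfl | rfl | rfl | rfl | rfl <;> simp)
    (by
      have : ((e * 8 : ℤ) : ZMod 16) = (8 : ℤ) := by
        rw [ZMod.intCast_eq_intCast_iff]
        show e * 8 % 16 = 8 % 16
        omega
      exact_mod_cast this)
    (by exact_mod_cast congrArg (Int.cast : ℤ → ZMod 16) h1)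
    (by exact_mod_cast congrArg (Int.cast : ℤ → ZMod 16) h2)
  constructor
  · have h : ((n * 8 : ℤ) : ZMod 16) = (8 : ℤ) := by exact_mod_cast this.1
    rw [ZMod.intCast_eq_intCast_iff] at h
    have h : n * 8 % 16 = 8 % 16 := h
    omega
  · have h : ((A * 4 : ℤ) : ZMod 16) = (0 : ℤ) := by exact_mod_cast this.2
    rw [ZMod.intCast_eq_intCast_iff] at h
    have h : A * 4 % 16 = 0 % 16 := h
    omega

theorem int_sq_of_rat {m : ℤ} (h : IsSquare (m : ℚ)) : ∃ B : ℤ, m = B ^ 2 := by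
  have := Rat.isSquare_intCast_iff.1 h
  obtain ⟨B, hB⟩ := this
  exact ⟨B, by rw [hB]; ring⟩

theorem val_four_smul (hn : n ∈ ({-1, 1, 2, 3, 7, 11} : Set ℤ)) (hW : IsE W (n : ℚ))
    (P : W.Point) {x y : ℚ} {h : W.Nonsingular x y}
    (hP : (2 : ℕ) • (2 : ℕ) • P = Affine.Point.some x y h) : padicValRat 2 x < 0 := by
  rcases hR : (2 : ℕ) • P with _ | ⟨x₁, y₁, h₁⟩
  · rw [hR, ← Affine.Point.zero_def, nsmul_zero] at hP
    exact absurd hP.symm (Affine.Point.some_ne_zero h)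
  rw [hR] at hP
  by_cases hv : padicValRat 2 x₁ < 0
  · obtain ⟨x₃, y₃, h₃, e, hh⟩ := val_dbl hW h₁ hv
    rw [e] at hP
    obtain ⟨rfl, rfl⟩ := (Affine.Point.some.injEq _ _ _ _ _ _).mp hP
    omega
  have hy : y₁ ≠ 0 := by
    intro hy
    rw [hW.dbl_zero h₁ hy] at hP
    exact absurd hP.symm (Affine.Point.some_ne_zero h)
  have e1 := hW.eq.1 h₁.1
  have hx0 : x₁ ≠ 0 := by
    rintro rfl
    apply hy
    simpa using e1
  obtain ⟨⟨u, hu⟩, s2, s3⟩ := hW.dbl_sq hR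
  have hu0 : u ≠ 0 := by rintro rfl; simp at hu; exact hx0 hu
  have hvu : padicValRat 2 x₁ = 2 * padicValRat 2 u := by
    rw [hu, padicValRat.mul hu0 hu0]; ring
  have hden : (u.den : ℤ) % 2 = 1 := by
    by_contra hcon
    have h2d : 2 ∣ u.den := by omega
    have h2n : ¬ (2 : ℤ) ∣ u.num := by
      intro h2
      have h3 : 2 ∣ u.num.natAbs := by omega
      have := Nat.dvd_gcd h3 h2d
      rw [u.reduced] at this
      omega
    have : padicValRat 2 u = (padicValInt 2 u.num : ℤ) - padicValNat 2 u.den := rfl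
    rw [padicValInt.eq_zero_of_not_dvd h2n] at this
    have h1 := one_le_padicValNat_of_dvd u.den_nz h2d
    rw [Nat.cast_zero] at this
    have h2 : (1 : ℤ) ≤ padicValNat 2 u.den := by exact_mod_cast h1
    omega
  set A := u.num with hA
  set e : ℤ := (u.den : ℤ) with he
  have he0 : (e : ℚ) ≠ 0 := by rw [he]; exact_mod_cast u.den_nz
  have hue : u * e = A := by rw [he, hA]; exact_mod_cast Rat.mul_den_eq_num u
  have sqm : ∀ m : ℤ, IsSquare (x₁ - m) → ∃ B : ℤ, A ^ 2 - m * e ^ 2 = B ^ 2 := by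
    rintro m ⟨v, hv⟩
    apply int_sq_of_rat
    refine ⟨v * e, ?_⟩
    push_cast
    rw [← hue]
    linear_combination (e : ℚ) ^ 2 * hv - (e : ℚ) ^ 2 * hu
  obtain ⟨B, hB⟩ := sqm n s2
  obtain ⟨C, hC⟩ := sqm (4 * n) (by push_cast; exact s3)
  obtain ⟨hn2, k, hk⟩ := mod_fact hn hden hB hC
  have hk0 : (k : ℚ) ≠ 0 := by
    intro h0
    apply hu0
    have : u * e = 0 := by rw [hue, hk]; push_cast; rw [h0]; ring
    simpa [he0] using this
  have hve : padicValRat 2 (e : ℚ) = 0 := by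
    rw [padicValRat.of_int, padicValInt.eq_zero_of_not_dvd (by omega)]; rfl
  have hvn : padicValRat 2 (n : ℚ) = 0 := by
    rw [padicValRat.of_int, padicValInt.eq_zero_of_not_dvd (by omega)]; rfl
  have hvu2 : 2 ≤ padicValRat 2 u := by
    have h1 := congrArg (padicValRat 2) hue
    rw [padicValRat.mul hu0 he0, hve, hk] at h1
    push_cast at h1
    rw [padicValRat.mul (by norm_num) hk0, val_four] at h1
    have := val_int k
    omega
  have hn0 := hW.n0
  have hv4n : padicValRat 2 (4 * (n : ℚ)) = 2 := by
    rw [padicValRat.mul (by norm_num) hn0, val_four, hvn]; rfl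
  have hv4n2 : padicValRat 2 (4 * (n : ℚ) ^ 2) = 2 := by
    rw [padicValRat.mul (by norm_num) (pow_ne_zero _ hn0), padicValRat.pow, val_four, hvn]; rfl
  obtain ⟨a1, a2⟩ := val_add_of_lt (q := -(n : ℚ)) (r := x₁) (neg_ne_zero.2 hn0)
    (Or.inr (by rw [padicValRat.neg]; omega))
  obtain ⟨b1, b2⟩ := val_add_of_lt (q := -(4 * (n : ℚ))) (r := x₁)
    (neg_ne_zero.2 (mul_ne_zero (by norm_num) hn0))
    (Or.inr (by rw [padicValRat.neg]; omega))
  obtain ⟨c1, c2⟩ := val_add_of_lt (q := -(4 * (n : ℚ) ^ 2)) (r := x₁ ^ 2)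
    (neg_ne_zero.2 (mul_ne_zero (by norm_num) (pow_ne_zero _ hn0)))
    (Or.inr (by rw [padicValRat.neg, padicValRat.pow]; push_cast; omega))
  rw [padicValRat.neg] at a2 b2 c2
  obtain ⟨x₃, y₃, h₃, e', a, -⟩ := hW.dbl h₁ hy
  rw [e'] at hP
  obtain ⟨rfl, rfl⟩ := (Affine.Point.some.injEq _ _ _ _ _ _).mp hP
  have := val_dbl_formula (x := x₁) (y := y₁) a1 b1 c1 hx0 (by rw [e1]; ring) (by rw [a]; ring)
  omega

theorem val_pow (hn : n ∈ ({-1, 1, 2, 3, 7, 11} : Set ℤ)) (hW : IsE W (n : ℚ))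
    (P : W.Point) (j : ℕ) : ∀ {x y : ℚ} {h : W.Nonsingular x y}
    (_ : (2 ^ j : ℕ) • (2 : ℕ) • (2 : ℕ) • P = Affine.Point.some x y h),
      padicValRat 2 x < - j := by
  induction j with
  | zero =>
    intro x y h hP
    rw [pow_zero, one_nsmul] at hP
    simpa using val_four_smul hn hW P hP
  | succ j ih =>
    intro x y h hP
    rw [pow_succ, mul_nsmul] at hP
    rcases hR : (2 ^ j : ℕ) • (2 : ℕ) • (2 : ℕ) • P with _ | ⟨x₁, y₁, h₁⟩
    · rw [hR, ← Affine.Point.zero_def, nsmul_zero] at hP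
      exact absurd hP.symm (Affine.Point.some_ne_zero h)
    have h1 := ih hR
    rw [hR] at hP
    obtain ⟨x₃, y₃, h₃, e, hh⟩ := val_dbl hW h₁ (by omega)
    rw [e] at hP
    obtain ⟨rfl, rfl⟩ := (Affine.Point.some.injEq _ _ _ _ _ _).mp hP
    push_cast
    omega

theorem four_torsion (hn : n ∈ ({-1, 1, 2, 3, 7, 11} : Set ℤ)) (hW : IsE W (n : ℚ))
    (hdiv : ∀ P : W.Point, ∃ Q S : W.Point, P = (2 : ℕ) • Q + S ∧ (4 : ℕ) • S = 0)
    (P : W.Point) : (2 : ℕ) • (2 : ℕ) • P = 0 := by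
  have key : ∀ k : ℕ, ∃ Q : W.Point, (2 : ℕ) • (2 : ℕ) • P = (2 ^ k : ℕ) • (2 : ℕ) • (2 : ℕ) • Q := by
    intro k
    induction k with
    | zero => exact ⟨P, by simp⟩
    | succ k ih =>
      obtain ⟨Q, hQ⟩ := ih
      obtain ⟨R, S, hR, hS⟩ := hdiv Q
      refine ⟨R, ?_⟩
      rw [hQ, hR]
      simp only [← mul_nsmul, nsmul_add] at hS ⊢
      have : (2 * 2 * 2 ^ k : ℕ) • S = 0 := by
        rw [mul_nsmul, show 2 * 2 = 4 from rfl, hS, nsmul_zero]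
      rw [this, add_zero]
      congr 1
      ring
  rcases hR : (2 : ℕ) • (2 : ℕ) • P with _ | ⟨x, y, h⟩
  · rfl
  exfalso
  obtain ⟨Q, hQ⟩ := key (padicValRat 2 x).natAbs
  rw [hR] at hQ
  have := val_pow hn hW Q _ hQ.symm
  omega
end rat

section classes

/-- Signed divisors. -/
def divs (m : ℕ) : List ℤ :=
  ((List.range (m + 1)).filter (fun k : ℕ => m % k == 0)).flatMap (fun k : ℕ => [(k : ℤ), -(k : ℤ)])

theorem mem_divs {d m : ℤ} (h : d ∣ m) (hm : m ≠ 0) : d ∈ divs m.natAbs := by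
  rw [divs, List.mem_flatMap]
  refine ⟨d.natAbs, ?_, ?_⟩
  · rw [List.mem_filter, List.mem_range]
    have h1 : d.natAbs ∣ m.natAbs := Int.natAbs_dvd_natAbs.2 h
    refine ⟨Nat.lt_succ_of_le (Nat.le_of_dvd (Int.natAbs_pos.2 hm) h1), ?_⟩
    simpa using Nat.mod_eq_zero_of_dvd h1
  · simp only [List.mem_cons, List.not_mem_nil, or_false]
    omega

/-- Membership of a residue in a list. -/
def resOk (m : ℤ) (S : List ℤ) (t : ℤ) : Bool := S.any fun c => (t - c) % m == 0

/-- Local solubility test. -/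
def loc (m l : ℤ) (S : List ℤ) (d0 d1 d2 d3 : ℤ) : Bool :=
  S.any fun a => S.any fun b =>
    !((d0 * a) % l == 0 && (d1 * b) % l == 0) &&
    (S.any fun c => (d1 * b - d0 * a - d2 * c) % m == 0) &&
    (S.any fun c => (d1 * b - 4 * (d0 * a) - d3 * c) % m == 0)

/-- All tests. -/
def test (n d0 d1 d2 d3 : ℤ) : Bool :=
  decide (0 < d0) && (decide (d3 < 0) || decide (0 < d2)) &&
  (decide (d2 < 0) || decide (0 < d1)) && decide (0 ≤ n * d0 * d1 * d2 * d3) &&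
  resOk 5 [0, 1, 4] (n * d0 * d1 * d2 * d3) &&
  resOk 13 [0, 1, 3, 4, 9, 10, 12] (n * d0 * d1 * d2 * d3) &&
  resOk 17 [0, 1, 2, 4, 8, 9, 13, 15, 16] (n * d0 * d1 * d2 * d3) &&
  resOk 19 [0, 1, 4, 5, 6, 7, 9, 11, 16, 17] (n * d0 * d1 * d2 * d3) &&
  resOk 23 [0, 1, 2, 3, 4, 6, 8, 9, 12, 13, 16, 18] (n * d0 * d1 * d2 * d3) &&
  loc 3 3 [0, 1] d0 d1 d2 d3 && loc 16 2 [0, 1, 4, 9] d0 d1 d2 d3 &&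
  loc 7 7 [0, 1, 2, 4] d0 d1 d2 d3 && loc 11 11 [0, 1, 3, 4, 5, 9] d0 d1 d2 d3

/-- Perfect square test. -/
def isSq (t : ℤ) : Bool := (List.range 400).any fun k => (k : ℤ) * k == t

theorem isSq_spec {t : ℤ} (h : isSq t = true) : ∃ k : ℤ, k * k = t := by
  rw [isSq, List.any_eq_true] at h
  obtain ⟨k, -, hk⟩ := h
  exact ⟨k, by simpa using hk⟩

/-- The complete check. -/
def check (n : ℤ) (C : List (ℤ × ℤ × ℤ)) : Bool :=
  (divs n.natAbs).all fun d0 => (divs (2 * n).natAbs).all fun d1 =>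
  (divs (3 * n).natAbs).all fun d2 => (divs (6 * n).natAbs).all fun d3 =>
    !(test n d0 d1 d2 d3) || C.any fun c =>
      isSq (n * c.1 * d0 * d1) && isSq (n * c.2.1 * d0 * d2) && isSq (n * c.2.2 * d0 * d3)

theorem check_m1 : check (-1) [(1, 1, 1), (-1, 0, 3), (2, 3, 6), (-2, -1, 2)] = true := by
  decide +kernel
theorem check_1 : check 1 [(1, 1, 1), (0, -1, -4), (1, 0, -3), (4, 3, 0)] = true := by
  decide +kernel
theorem check_2 : check 2 [(1, 1, 1), (0, -2, -8), (2, 0, -6), (8, 6, 0)] = true := by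
  decide +kernel
theorem check_3 : check 3 [(1, 1, 1), (0, -3, -12), (3, 0, -9), (12, 9, 0)] = true := by
  decide +kernel
theorem check_7 : check 7 [(1, 1, 1), (0, -7, -28), (7, 0, -21), (28, 21, 0)] = true := by
  decide +kernel
theorem check_11 : check 11 [(1, 1, 1), (0, -11, -44), (11, 0, -33), (44, 33, 0)] = true := by
  decide +kernel

theorem exists_sqf (m : ℤ) (hm : m ≠ 0) : ∃ d s : ℤ, m = d * s ^ 2 ∧ Squarefree d ∧ s ≠ 0 := by
  obtain ⟨a, b, h, ha⟩ := Nat.sq_mul_squarefree m.natAbs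
  have hb : (b : ℤ) ≠ 0 := by
    rintro h0
    have : b = 0 := by exact_mod_cast h0
    subst this
    simp at h
    omega
  have ha' : Squarefree (a : ℤ) := by
    rw [← Int.squarefree_natAbs]; simpa using ha
  have hz : (b : ℤ) ^ 2 * a = m.natAbs := by exact_mod_cast h
  rcases Int.natAbs_eq m with h1 | h1
  · exact ⟨a, b, by rw [h1, ← hz]; ring, ha', hb⟩
  · refine ⟨-a, b, by rw [h1, ← hz]; ring, ?_, hb⟩
    rw [← Int.squarefree_natAbs]; simpa using ha

theorem sqf_prime {d m t l : ℤ} (h : d * m = t ^ 2) (hd : Squarefree d) (hl : Prime l)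
    (hld : l ∣ d) : l ∣ m := by
  have h1 : l ∣ t := hl.dvd_of_dvd_pow (h ▸ hld.mul_right m)
  obtain ⟨k, rfl⟩ := hld
  obtain ⟨u, rfl⟩ := h1
  have h2 : k * m = l * u ^ 2 := by
    apply mul_left_cancel₀ hl.ne_zero
    linear_combination h
  have h3 : l ∣ k * m := ⟨_, h2⟩
  rcases hl.dvd_or_dvd h3 with h4 | h4
  · exact absurd (hd l (mul_dvd_mul_left l h4)) hl.not_isUnit
  · exact h4

theorem sqf_dvd {d m : ℤ} (hd : Squarefree d) (hm : m ≠ 0)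
    (h : ∀ l : ℤ, Prime l → l ∣ d → l ∣ m) : d ∣ m := by
  rw [← Int.natAbs_dvd_natAbs]
  have hd' : Squarefree d.natAbs := Int.squarefree_natAbs.2 hd
  rw [← Nat.prod_primeFactors_of_squarefree hd']
  refine dvd_trans (Finset.prod_dvd_prod_of_subset _ _ _ ?_) (Nat.prod_primeFactors_dvd m.natAbs)
  intro p hp
  rw [Nat.mem_primeFactors] at hp ⊢
  refine ⟨hp.1, ?_, Int.natAbs_ne_zero.2 hm⟩
  have := h p (Nat.prime_iff_prime_int.1 hp.1) (Int.natCast_dvd.2 hp.2.1)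
  exact Int.natCast_dvd.1 this

theorem resOk_sq (m : ℕ) (S : List ℤ) (hm : 0 < m)
    (hS : ((List.range m).all fun k => S.any fun c => ((k : ℤ) * k - c) % m == 0) = true) (s : ℤ) :
    ∃ c ∈ S, (m : ℤ) ∣ s ^ 2 - c := by
  rw [List.all_eq_true] at hS
  have h0 : 0 ≤ s % m := Int.emod_nonneg _ (by omega)
  have h1 : s % m < m := Int.emod_lt_of_pos _ (by omega)
  have := hS (s % m).toNat (by rw [List.mem_range]; omega)
  rw [List.any_eq_true] at this
  obtain ⟨c, hc, h⟩ := this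
  refine ⟨c, hc, ?_⟩
  rw [Int.toNat_of_nonneg h0] at h
  have h2 : (m : ℤ) ∣ (s % m) * (s % m) - c := Int.dvd_of_emod_eq_zero (by simpa using h)
  have h3 : (m : ℤ) ∣ s - s % m := Int.dvd_self_sub_emod
  have : s ^ 2 - c = (s - s % m) * (s + s % m) + ((s % m) * (s % m) - c) := by ring
  rw [this]
  exact dvd_add (h3.mul_right _) h2

theorem resOk_true (m : ℕ) (S : List ℤ) (hm : 0 < m)
    (hS : ((List.range m).all fun k => S.any fun c => ((k : ℤ) * k - c) % m == 0) = true)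
    {t s : ℤ} (ht : t = s ^ 2) : resOk m S t = true := by
  obtain ⟨c, hc, h⟩ := resOk_sq m S hm hS s
  rw [resOk, List.any_eq_true]
  exact ⟨c, hc, by rw [ht]; simpa using Int.emod_eq_zero_of_dvd h⟩

theorem loc_true (m : ℕ) (l : ℤ) (S : List ℤ) (hm : 0 < m)
    (hS : ((List.range m).all fun k => S.any fun c => ((k : ℤ) * k - c) % m == 0) = true)
    (hl : l ∣ m) (hl1 : ¬ IsUnit l) {p q d0 d1 d2 d3 s0 s1 s2 s3 : ℤ} (hpq : IsCoprime p q)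
    (h0 : q = d0 * s0 ^ 2) (h1 : p = d1 * s1 ^ 2) (h2 : p - q = d2 * s2 ^ 2)
    (h3 : p - 4 * q = d3 * s3 ^ 2) : loc m l S d0 d1 d2 d3 = true := by
  obtain ⟨a, ha, a'⟩ := resOk_sq m S hm hS s0
  obtain ⟨b, hb, b'⟩ := resOk_sq m S hm hS s1
  obtain ⟨c, hc, c'⟩ := resOk_sq m S hm hS s2
  obtain ⟨e, he, e'⟩ := resOk_sq m S hm hS s3
  rw [loc, List.any_eq_true]
  refine ⟨a, ha, ?_⟩
  rw [List.any_eq_true]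
  refine ⟨b, hb, ?_⟩
  have ka : (m : ℤ) ∣ q - d0 * a := by
    rw [h0, show d0 * s0 ^ 2 - d0 * a = d0 * (s0 ^ 2 - a) by ring]; exact a'.mul_left _
  have kb : (m : ℤ) ∣ p - d1 * b := by
    rw [h1, show d1 * s1 ^ 2 - d1 * b = d1 * (s1 ^ 2 - b) by ring]; exact b'.mul_left _
  have kc : (m : ℤ) ∣ p - q - d2 * c := by
    rw [h2, show d2 * s2 ^ 2 - d2 * c = d2 * (s2 ^ 2 - c) by ring]; exact c'.mul_left _
  have ke : (m : ℤ) ∣ p - 4 * q - d3 * e := by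
    rw [h3, show d3 * s3 ^ 2 - d3 * e = d3 * (s3 ^ 2 - e) by ring]; exact e'.mul_left _
  rw [Bool.and_eq_true, Bool.and_eq_true, List.any_eq_true, List.any_eq_true]
  refine ⟨⟨?_, c, hc, ?_⟩, e, he, ?_⟩
  · simp only [Bool.not_eq_true', Bool.and_eq_false_iff, beq_eq_false_iff_ne]
    by_contra hcon
    push Not at hcon
    obtain ⟨x0, x1⟩ := hcon
    have y0 : l ∣ q := (dvd_sub_left (Int.dvd_of_emod_eq_zero x0)).1 (hl.trans ka)
    have y1 : l ∣ p := (dvd_sub_left (Int.dvd_of_emod_eq_zero x1)).1 (hl.trans kb)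
    exact hl1 (hpq.isUnit_of_dvd' y1 y0)
  · rw [beq_iff_eq]
    apply Int.emod_eq_zero_of_dvd
    have : d1 * b - d0 * a - d2 * c = (p - q - d2 * c) - (p - d1 * b) + (q - d0 * a) := by ring
    rw [this]
    exact dvd_add (dvd_sub kc kb) ka
  · rw [beq_iff_eq]
    apply Int.emod_eq_zero_of_dvd
    have : d1 * b - 4 * (d0 * a) - d3 * e =
      (p - 4 * q - d3 * e) - (p - d1 * b) + 4 * (q - d0 * a) := by ring
    rw [this]
    exact dvd_add (dvd_sub ke kb) (ka.mul_left _)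

theorem class_int {n : ℤ} {C : List (ℤ × ℤ × ℤ)} (hC : check n C = true) (hn : n ≠ 0)
    {p q z : ℤ} (hpq : IsCoprime p q) (hq : 0 < q) (hz : z ≠ 0)
    (h : n * p * q * (p - q) * (p - 4 * q) = z ^ 2) :
    ∃ c ∈ C, IsSquare ((n * p / q : ℚ) * c.1) ∧ IsSquare ((n * p / q - n : ℚ) * c.2.1) ∧
      IsSquare ((n * p / q - 4 * n : ℚ) * c.2.2) := by
  have hprod : n * p * q * (p - q) * (p - 4 * q) ≠ 0 := by rw [h]; exact pow_ne_zero _ hz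
  have hp0 : p ≠ 0 := by rintro rfl; simp at hprod
  have hpq1 : p - q ≠ 0 := by intro h0; rw [h0] at hprod; simp at hprod
  have hpq4 : p - 4 * q ≠ 0 := by intro h0; rw [h0] at hprod; simp at hprod
  obtain ⟨d0, s0, h0, f0, g0⟩ := exists_sqf q hq.ne'
  obtain ⟨d1, s1, h1, f1, g1⟩ := exists_sqf p hp0
  obtain ⟨d2, s2, h2, f2, g2⟩ := exists_sqf (p - q) hpq1
  obtain ⟨d3, s3, h3, f3, g3⟩ := exists_sqf (p - 4 * q) hpq4
  obtain ⟨t, ht⟩ : ∃ t, n * d0 * d1 * d2 * d3 = t ^ 2 := by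
    have e1 : (n * d0 * d1 * d2 * d3) * (s0 * s1 * s2 * s3) ^ 2 = z ^ 2 := by
      rw [← h, h2, h3, h1, h0]; ring
    have e2 : (s0 * s1 * s2 * s3) ^ 2 ∣ z ^ 2 := ⟨n * d0 * d1 * d2 * d3, by rw [← e1]; ring⟩
    rw [Int.pow_dvd_pow_iff two_ne_zero] at e2
    obtain ⟨t, rfl⟩ := e2
    refine ⟨t, mul_right_cancel₀ (b := (s0 * s1 * s2 * s3) ^ 2) ?_ (by rw [e1]; ring)⟩
    exact pow_ne_zero _ (mul_ne_zero (mul_ne_zero (mul_ne_zero g0 g1) g2) g3)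
  have v0 : d0 ∣ q := ⟨_, h0⟩
  have v1 : d1 ∣ p := ⟨_, h1⟩
  have v2 : d2 ∣ p - q := ⟨_, h2⟩
  have v3 : d3 ∣ p - 4 * q := ⟨_, h3⟩
  have cop : ∀ l : ℤ, Prime l → l ∣ p → l ∣ q → False := fun l hl a b =>
    hl.not_isUnit (hpq.isUnit_of_dvd' a b)
  have c01 : ∀ l : ℤ, Prime l → l ∣ d0 → l ∣ d1 → False := fun l hl a b =>
    cop l hl (b.trans v1) (a.trans v0)
  have c02 : ∀ l : ℤ, Prime l → l ∣ d0 → l ∣ d2 → False := fun l hl a b =>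
    cop l hl ((dvd_sub_left (a.trans v0)).1 (b.trans v2)) (a.trans v0)
  have c03 : ∀ l : ℤ, Prime l → l ∣ d0 → l ∣ d3 → False := fun l hl a b =>
    cop l hl ((dvd_sub_left ((a.trans v0).mul_left 4)).1 (b.trans v3)) (a.trans v0)
  have c12 : ∀ l : ℤ, Prime l → l ∣ d1 → l ∣ d2 → False := fun l hl a b =>
    cop l hl (a.trans v1) ((dvd_sub_right (a.trans v1)).1 (b.trans v2))
  have c13 : ∀ l : ℤ, Prime l → l ∣ d1 → l ∣ d3 → l ∣ 2 := fun l hl a b => by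
    have := (dvd_sub_right (a.trans v1)).1 (b.trans v3)
    rcases hl.dvd_or_dvd this with k | k
    · exact hl.dvd_of_dvd_pow (n := 2) (by norm_num; exact k)
    · exact (cop l hl (a.trans v1) k).elim
  have c23 : ∀ l : ℤ, Prime l → l ∣ d2 → l ∣ d3 → l ∣ 3 := fun l hl a b => by
    have k3 : l ∣ 3 * q := by
      rw [show 3 * q = (p - q) - (p - 4 * q) by ring]
      exact dvd_sub (a.trans v2) (b.trans v3)
    rcases hl.dvd_or_dvd k3 with k | k
    · exact k
    · exact (cop l hl ((dvd_sub_left k).1 (a.trans v2)) k).elim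
  have split4 : ∀ {l a b c d : ℤ}, Prime l → l ∣ a * b * c * d → l ∣ a ∨ l ∣ b ∨ l ∣ c ∨ l ∣ d := by
    intro l a b c d hl hh
    rcases hl.dvd_or_dvd hh with hh | hh
    · rcases hl.dvd_or_dvd hh with hh | hh
      · rcases hl.dvd_or_dvd hh with hh | hh <;> tauto
      · tauto
    · tauto
  have D0 : d0 ∣ n := by
    refine sqf_dvd f0 hn fun l hl hd => ?_
    have := sqf_prime (d := d0) (m := n * d1 * d2 * d3) (by rw [← ht]; ring) f0 hl hd
    rcases split4 hl this with k | k | k | k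
    · exact k
    · exact (c01 l hl hd k).elim
    · exact (c02 l hl hd k).elim
    · exact (c03 l hl hd k).elim
  have D1 : d1 ∣ 2 * n := by
    refine sqf_dvd f1 (mul_ne_zero two_ne_zero hn) fun l hl hd => ?_
    have := sqf_prime (d := d1) (m := n * d0 * d2 * d3) (by rw [← ht]; ring) f1 hl hd
    rcases split4 hl this with k | k | k | k
    · exact k.mul_left _
    · exact (c01 l hl k hd).elim
    · exact (c12 l hl hd k).elim
    · exact (c13 l hl hd k).mul_right _
  have D2 : d2 ∣ 3 * n := by
    refine sqf_dvd f2 (mul_ne_zero three_ne_zero hn) fun l hl hd => ?_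
    have := sqf_prime (d := d2) (m := n * d0 * d1 * d3) (by rw [← ht]; ring) f2 hl hd
    rcases split4 hl this with k | k | k | k
    · exact k.mul_left _
    · exact (c02 l hl k hd).elim
    · exact (c12 l hl k hd).elim
    · exact (c23 l hl hd k).mul_right _
  have D3 : d3 ∣ 6 * n := by
    refine sqf_dvd f3 (mul_ne_zero (by norm_num) hn) fun l hl hd => ?_
    have := sqf_prime (d := d3) (m := n * d0 * d1 * d2) (by rw [← ht]; ring) f3 hl hd
    rcases split4 hl this with k | k | k | k
    · exact k.mul_left _
    · exact (c03 l hl k hd).elim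
    · exact ((c13 l hl k hd).trans ⟨3, by norm_num⟩).mul_right _
    · exact ((c23 l hl k hd).trans ⟨2, by norm_num⟩).mul_right _
  have P0 : 0 < s0 ^ 2 := by positivity
  have P1 : 0 < s1 ^ 2 := by positivity
  have P2 : 0 < s2 ^ 2 := by positivity
  have P3 : 0 < s3 ^ 2 := by positivity
  have T : test n d0 d1 d2 d3 = true := by
    simp only [test, Bool.and_eq_true, Bool.or_eq_true, decide_eq_true_eq]
    refine ⟨⟨⟨⟨⟨⟨⟨⟨⟨⟨⟨⟨?_, ?_⟩, ?_⟩, ?_⟩, ?_⟩, ?_⟩, ?_⟩, ?_⟩, ?_⟩, ?_⟩, ?_⟩, ?_⟩, ?_⟩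
    · rw [h0] at hq; exact pos_of_mul_pos_left hq P0.le
    · by_contra hcon
      push Not at hcon
      have a := mul_nonneg hcon.1 P3.le
      have b := mul_nonpos_of_nonpos_of_nonneg hcon.2 P2.le
      omega
    · by_contra hcon
      push Not at hcon
      have a := mul_nonneg hcon.1 P2.le
      have b := mul_nonpos_of_nonpos_of_nonneg hcon.2 P1.le
      omega
    · rw [ht]; positivity
    · exact resOk_true 5 _ (by norm_num) (by decide) ht
    · exact resOk_true 13 _ (by norm_num) (by decide) ht
    · exact resOk_true 17 _ (by norm_num) (by decide) ht
    · exact resOk_true 19 _ (by norm_num) (by decide) ht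
    · exact resOk_true 23 _ (by norm_num) (by decide) ht
    · exact loc_true 3 3 _ (by norm_num) (by decide) (by norm_num) (by decide) hpq h0 h1 h2 h3
    · exact loc_true 16 2 _ (by norm_num) (by decide) (by norm_num) (by decide) hpq h0 h1 h2 h3
    · exact loc_true 7 7 _ (by norm_num) (by decide) (by norm_num) (by decide) hpq h0 h1 h2 h3
    · exact loc_true 11 11 _ (by norm_num) (by decide) (by norm_num) (by decide) hpq h0 h1 h2 h3
  rw [check, List.all_eq_true] at hC
  have C1 := hC d0 (mem_divs D0 hn)
  rw [List.all_eq_true] at C1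
  have C2 := C1 d1 (mem_divs D1 (mul_ne_zero two_ne_zero hn))
  rw [List.all_eq_true] at C2
  have C3 := C2 d2 (mem_divs D2 (mul_ne_zero three_ne_zero hn))
  rw [List.all_eq_true] at C3
  have C4 := C3 d3 (mem_divs D3 (mul_ne_zero (by norm_num) hn))
  rw [T, Bool.not_true, Bool.false_or, List.any_eq_true] at C4
  obtain ⟨c, hc, hh⟩ := C4
  rw [Bool.and_eq_true, Bool.and_eq_true] at hh
  refine ⟨c, hc, ?_⟩
  have hqQ : (q : ℚ) ≠ 0 := by exact_mod_cast hq.ne'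
  have fin : ∀ r d s c : ℤ, r = d * s ^ 2 → isSq (n * c * d0 * d) = true →
      IsSquare ((n * r / q : ℚ) * c) := by
    intro r d s c hr hs
    obtain ⟨k, hk⟩ := isSq_spec hs
    refine isSquare_of_mul (b := (q : ℚ)) (c := k * s * s0) ?_ hqQ
    have hk' : (k : ℚ) * k = n * c * d0 * d := by exact_mod_cast hk
    have hr' : (r : ℚ) = d * s ^ 2 := by exact_mod_cast hr
    have h0' : (q : ℚ) = d0 * s0 ^ 2 := by exact_mod_cast h0
    have : (n * r / q : ℚ) * c * q ^ 2 = n * r * c * q := by field_simp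
    rw [this, hr', h0']
    linear_combination -(s : ℚ) ^ 2 * s0 ^ 2 * hk'
  refine ⟨fin p d1 s1 _ h1 hh.1.1, ?_, ?_⟩
  · have := fin (p - q) d2 s2 _ h2 hh.1.2
    have e : (n * p / q - n : ℚ) = n * ((p - q : ℤ) : ℚ) / q := by push_cast; field_simp
    rwa [e]
  · have := fin (p - 4 * q) d3 s3 _ h3 hh.2
    have e : (n * p / q - 4 * n : ℚ) = n * ((p - 4 * q : ℤ) : ℚ) / q := by push_cast; field_simp
    rwa [e]

theorem class_rat {n : ℤ} {C : List (ℤ × ℤ × ℤ)} (hC : check n C = true) (hn : n ≠ 0)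
    {X Y : ℚ} (hY : Y ≠ 0) (h : Y ^ 2 = X * (X - n) * (X - 4 * n)) :
    ∃ c ∈ C, IsSquare (X * c.1) ∧ IsSquare ((X - n) * c.2.1) ∧ IsSquare ((X - 4 * n) * c.2.2) := by
  have hnQ : (n : ℚ) ≠ 0 := by exact_mod_cast hn
  obtain ⟨x, hx⟩ : ∃ x : ℚ, x = X / n := ⟨_, rfl⟩
  have hX : X = n * x := by rw [hx]; field_simp
  have hdn : (x.den : ℚ) ≠ 0 := by exact_mod_cast x.den_nz
  have hnum : x * x.den = x.num := Rat.mul_den_eq_num x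
  have hxX : (n * (x.num : ℤ) / ((x.den : ℤ) : ℚ) : ℚ) = X := by
    rw [hX, ← hnum]; push_cast; field_simp
  have hcop : IsCoprime x.num (x.den : ℤ) := by
    rw [Int.isCoprime_iff_gcd_eq_one]; exact x.reduced
  obtain ⟨z, hz⟩ := int_sq_of_rat
    (m := n * x.num * x.den * (x.num - x.den) * (x.num - 4 * x.den)) ⟨Y * x.den ^ 2 / n, by
      push_cast
      rw [← hnum]
      field_simp
      rw [h, hX]; ring⟩
  have hz0 : z ≠ 0 := by
    rintro rfl
    apply hY
    have hz' : (n * x.num * x.den * (x.num - x.den) * (x.num - 4 * x.den) : ℚ) = 0 := by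
      exact_mod_cast hz
    rw [← hnum] at hz'
    have : Y ^ 2 * (x.den : ℚ) ^ 4 = 0 := by
      rw [h, hX]
      linear_combination (n : ℚ) ^ 2 * hz'
    simpa [hdn] using this
  have := class_int hC hn hcop (by exact_mod_cast x.den_pos) hz0 hz
  rw [hxX] at this
  exact this
end classes

section ranks

/-- The curve. -/
def EC (n : ℤ) : WeierstrassCurve ℚ := ⟨0, -5 * n, 0, 4 * n ^ 2, 0⟩

theorem EC_isE {n : ℤ} (hn : n ≠ 0) : IsE (EC n) (n : ℚ) :=
  ⟨rfl, rfl, rfl, rfl, rfl, by exact_mod_cast hn⟩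

variable {W : WeierstrassCurve.Affine ℚ} {n : ℤ}

theorem four_zero (hW : IsE W (n : ℚ)) {x y : ℚ} (h : W.Nonsingular x y) (hy : y = 0) :
    (4 : ℕ) • Affine.Point.some x y h = 0 := by
  rw [show 4 = 2 * 2 from rfl, mul_nsmul, hW.dbl_zero h hy, nsmul_zero]

theorem four_two (hW : IsE W (n : ℚ)) {x y : ℚ} (h : W.Nonsingular x y) (hy : y ≠ 0)
    (hx : x ^ 2 = 4 * (n : ℚ) ^ 2) : (4 : ℕ) • Affine.Point.some x y h = 0 := by
  obtain ⟨x₃, y₃, h₃, e, e1, -, -, -⟩ := hW.dbl h hy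
  rw [show 4 = 2 * 2 from rfl, mul_nsmul, e]
  apply hW.dbl_zero
  have hx3 : x₃ = 0 := by
    have : x₃ * (2 * y) ^ 2 = 0 := by rw [e1, hx]; ring
    rcases mul_eq_zero.1 this with h | h
    · exact h
    · simp at h; exact absurd h hy
  have := hW.eq.1 h₃.1
  rw [hx3] at this
  simpa using this

theorem div_of_check (hn : n ≠ 0) (hW : IsE W (n : ℚ)) {C : List (ℤ × ℤ × ℤ)}
    (hC : check n C = true)
    (hT : ∀ c ∈ C, c = (1, 1, 1) ∨ ∃ t s : ℤ, c = (t, t - n, t - 4 * n) ∧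
      s ^ 2 = t * (t - n) * (t - 4 * n) ∧ (s = 0 ∨ t ^ 2 = 4 * n ^ 2))
    (P : W.Point) : ∃ Q S : W.Point, P = (2 : ℕ) • Q + S ∧ (4 : ℕ) • S = 0 := by
  rcases P with _ | ⟨x, y, h⟩
  · exact ⟨0, 0, by rw [nsmul_zero, add_zero]; rfl, nsmul_zero _⟩
  by_cases hy : y = 0
  · exact ⟨0, _, by rw [nsmul_zero, zero_add], four_zero hW h hy⟩
  obtain ⟨c, hc, h1, h2, h3⟩ := class_rat hC hn hy (hW.eq.1 h.1)
  rcases hT c hc with rfl | ⟨t, s, rfl, hs, hs'⟩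
  · obtain ⟨Q, hQ⟩ := hW.halve h (by simpa using h1) (by simpa using h2) (by simpa using h3)
    exact ⟨Q, 0, by rw [hQ, add_zero], nsmul_zero _⟩
  · have hsQ : (s : ℚ) ^ 2 = t * (t - n) * (t - 4 * n) := by exact_mod_cast hs
    have hTn := hW.ns hsQ
    push_cast at h1 h2 h3
    refine hW.coset h hTn ?_ h1 h2 h3
    by_cases h0 : s = 0
    · exact four_zero hW _ (by exact_mod_cast h0)
    · refine four_two hW _ (by exact_mod_cast h0) ?_
      exact_mod_cast hs'.resolve_left h0

theorem pos_two_torsion (hn : n ∈ ({1, 2, 3, 7, 11} : Set ℤ)) {X Y : ℚ}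
    (h : Y ^ 2 = X * (X - n) * (X - 4 * n)) : Y = 0 := by
  have hn0 : 0 < n := by rcases hn with rfl | rfl | rfl | rfl | rfl <;> norm_num
  have hnQ : (0 : ℚ) < n := by exact_mod_cast hn0
  have hW := EC_isE hn0.ne'
  have hC : check n [(1, 1, 1), (0, 0 - n, 0 - 4 * n), (n, n - n, n - 4 * n),
      (4 * n, 4 * n - n, 4 * n - 4 * n)] = true := by
    rcases hn with rfl | rfl | rfl | rfl | rfl
    · exact check_1
    · exact check_2
    · exact check_3
    · exact check_7
    · exact check_11
  have hdiv := div_of_check hn0.ne' hW hC (by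
    intro c hc
    simp only [List.mem_cons, List.not_mem_nil, or_false] at hc
    rcases hc with rfl | rfl | rfl | rfl
    · exact Or.inl rfl
    · exact Or.inr ⟨0, 0, rfl, by ring, Or.inl rfl⟩
    · exact Or.inr ⟨n, 0, rfl, by ring, Or.inl rfl⟩
    · exact Or.inr ⟨4 * n, 0, rfl, by ring, Or.inl rfl⟩)
  have h4 := four_torsion (Set.mem_insert_of_mem _ hn) hW hdiv
    (Affine.Point.some X Y (hW.ns h))
  by_contra hY
  obtain ⟨x₃, y₃, h₃, e, -⟩ := hW.dbl (hW.ns h) hY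
  obtain ⟨q1, q2, q3⟩ := hW.dbl_sq e
  rw [e] at h4
  have hy3 : y₃ = 0 := by
    by_contra hy3
    obtain ⟨x₄, y₄, h₄', e', -⟩ := hW.dbl h₃ hy3
    rw [e'] at h4
    exact Affine.Point.some_ne_zero _ h4
  have e3 := hW.eq.1 h₃.1
  rw [hy3] at e3
  have n1 := q1.nonneg
  have n2 := q2.nonneg
  have n3 := q3.nonneg
  have : x₃ = 4 * n := by
    have : x₃ * (x₃ - n) * (x₃ - 4 * n) = 0 := by rw [← e3]; norm_num
    rcases mul_eq_zero.1 this with h | h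
    · rcases mul_eq_zero.1 h with h | h
      · linarith
      · linarith
    · linarith
  subst this
  obtain ⟨w, hw⟩ := q1.mul q2
  have q5 : IsSquare ((3 : ℤ) : ℚ) := isSquare_of_mul (b := 2 * (n : ℚ)) (c := w)
    (by push_cast; linear_combination hw) (by positivity)
  obtain ⟨B, hB⟩ := int_sq_of_rat q5
  have b1 : B < 2 := by nlinarith
  have b2 : -2 < B := by nlinarith
  interval_cases B <;> norm_num at hB

theorem neg_points {X Y : ℚ} (h : Y ^ 2 = X * (X + 1) * (X + 4)) :
    X = 0 ∨ X = -1 ∨ X = -4 ∨ X ^ 2 = 4 := by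
  have hW := EC_isE (n := -1) (by norm_num)
  have h' : Y ^ 2 = X * (X - (-1 : ℤ)) * (X - 4 * (-1 : ℤ)) := by rw [h]; push_cast; ring
  have hdiv := div_of_check (n := -1) (by norm_num) hW check_m1 (by
    intro c hc
    simp only [List.mem_cons, List.not_mem_nil, or_false] at hc
    rcases hc with rfl | rfl | rfl | rfl
    · exact Or.inl rfl
    · exact Or.inr ⟨-1, 0, by norm_num, by norm_num, Or.inl rfl⟩
    · exact Or.inr ⟨2, 6, by norm_num, by norm_num, Or.inr (by norm_num)⟩
    · exact Or.inr ⟨-2, 2, by norm_num, by norm_num, Or.inr (by norm_num)⟩)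
  have h4 := four_torsion (by simp) hW hdiv (Affine.Point.some X Y (hW.ns h'))
  by_cases hY : Y = 0
  · rw [hY] at h
    have : X * (X + 1) * (X + 4) = 0 := by rw [← h]; norm_num
    rcases mul_eq_zero.1 this with h | h
    · rcases mul_eq_zero.1 h with h | h
      · exact Or.inl h
      · exact Or.inr (Or.inl (by linarith))
    · exact Or.inr (Or.inr (Or.inl (by linarith)))
  obtain ⟨x₃, y₃, h₃, e, e1, -⟩ := hW.dbl (hW.ns h') hY
  obtain ⟨q1, q2, q3⟩ := hW.dbl_sq e
  rw [e] at h4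
  have hy3 : y₃ = 0 := by
    by_contra hy3
    obtain ⟨x₄, y₄, h₄', e', -⟩ := hW.dbl h₃ hy3
    rw [e'] at h4
    exact Affine.Point.some_ne_zero _ h4
  have e3 := hW.eq.1 h₃.1
  rw [hy3] at e3
  have n1 := q1.nonneg
  push_cast at e3 e1
  have : x₃ = 0 := by
    have : x₃ * (x₃ + 1) * (x₃ + 4) = 0 := by linear_combination -e3
    rcases mul_eq_zero.1 this with h | h
    · rcases mul_eq_zero.1 h with h | h
      · linarith
      · linarith
    · linarith
  rw [this, zero_mul] at e1
  have := pow_eq_zero_iff (two_ne_zero) |>.1 e1.symm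
  right; right; right; linarith
end ranks

section quad
variable {K : Type*} [Field K] [NumberField K]

theorem r_not_rat {D : ℤ} (hD : D < 0) {r : K} (hr : r ^ 2 = (D : K)) (q : ℚ) : (q : K) ≠ r := by
  rintro rfl
  have : q ^ 2 = (D : ℚ) := by exact_mod_cast hr
  have h2 : (D : ℚ) < 0 := by exact_mod_cast hD
  nlinarith [sq_nonneg q]

theorem decomp (hdeg : Module.finrank ℚ K = 2) {r : K} (hr : ∀ q : ℚ, (q : K) ≠ r) (z : K) :
    ∃ a b : ℚ, z = a + b * r := by
  have hli : LinearIndependent ℚ ![(1 : K), r] := by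
    rw [LinearIndependent.pair_iff]
    intro s t h
    rw [Rat.smul_def, Rat.smul_def, mul_one] at h
    by_cases ht : t = 0
    · subst ht
      simp at h
      exact ⟨h, rfl⟩
    · exfalso
      apply hr (-s / t)
      have ht' : (t : K) ≠ 0 := by exact_mod_cast ht
      push_cast
      field_simp
      linear_combination -h
  have hspan := hli.span_eq_top_of_card_eq_finrank' (by rw [hdeg]; rfl)
  have hz : z ∈ Submodule.span ℚ (Set.range ![(1 : K), r]) := by rw [hspan]; trivial
  rw [Matrix.range_cons, Matrix.range_cons, Matrix.range_empty, Set.union_empty,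
    Set.singleton_union, Submodule.mem_span_pair] at hz
  obtain ⟨a, b, h⟩ := hz
  exact ⟨a, b, by rw [← h, Rat.smul_def, Rat.smul_def, mul_one]⟩

theorem indep {r : K} (hr : ∀ q : ℚ, (q : K) ≠ r) {a b : ℚ} (h : (a : K) + b * r = 0) : b = 0 := by
  by_contra hb
  have hb' : (b : K) ≠ 0 := by exact_mod_cast hb
  apply hr (-a / b)
  push_cast
  field_simp
  linear_combination -h

theorem exists_conj (hdeg : Module.finrank ℚ K = 2) {D : ℤ} {r : K} (hrD : r ^ 2 = (D : K))
    (hr : ∀ q : ℚ, (q : K) ≠ r) : ∃ σ : K →ₐ[ℚ] K, σ r = -r := by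
  have : Algebra.IsQuadraticExtension ℚ K := ⟨hdeg⟩
  have : IsGalois ℚ K := inferInstance
  have h1 : r ∉ (⊥ : IntermediateField ℚ K) := by
    rw [IntermediateField.mem_bot]
    rintro ⟨q, hq⟩
    exact hr q (by rw [← hq]; simp)
  rw [IsGalois.mem_bot_iff_fixed] at h1
  push Not at h1
  obtain ⟨f, hf⟩ := h1
  refine ⟨f.toAlgHom, ?_⟩
  have h2 : (f r) ^ 2 = r ^ 2 := by rw [← map_pow, hrD, map_intCast]
  rcases sq_eq_sq_iff_eq_or_eq_neg.1 h2 with h | h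
  · exact absurd h hf
  · exact h

theorem rat_sq (hdeg : Module.finrank ℚ K = 2) {D : ℤ} (hD : D < 0) {r : K}
    (hrD : r ^ 2 = (D : K)) {q : ℚ} (hq : 0 < q) (h : IsSquare (q : K)) : IsSquare q := by
  have hr := r_not_rat hD hrD
  obtain ⟨z, hz⟩ := h
  obtain ⟨a, b, rfl⟩ := decomp hdeg hr z
  have h2 : ((a ^ 2 + D * b ^ 2 - q : ℚ) : K) + ((2 * a * b : ℚ) : K) * r = 0 := by
    push_cast
    linear_combination -hz - (b : K) ^ 2 * hrD
  have h3 := indep hr h2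
  rw [h3] at h2
  have h4 : a ^ 2 + D * b ^ 2 - q = 0 := by
    rw [Rat.cast_zero, zero_mul, add_zero] at h2
    exact_mod_cast h2
  have h2 : (D : ℚ) < 0 := by exact_mod_cast hD
  rcases mul_eq_zero.1 h3 with h | h
  · have : a = 0 := by linarith
    subst this
    nlinarith [sq_nonneg b]
  · subst h
    exact ⟨a, by linarith⟩

theorem not_sq {m : ℤ} (hm : m = 2 ∨ m = 3 ∨ m = 12) : ¬ IsSquare (m : ℚ) := by
  intro h
  obtain ⟨B, hB⟩ := int_sq_of_rat h
  have b1 : B < 4 := by rcases hm with rfl | rfl | rfl <;> nlinarith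
  have b2 : -4 < B := by rcases hm with rfl | rfl | rfl <;> nlinarith
  interval_cases B <;> omega

theorem baseE : IsE (((EC (-1)).baseChange K : WeierstrassCurve K).toAffine) (-1 : K) := by
  constructor <;> simp [EC, WeierstrassCurve.baseChange]

theorem K_points {D : ℤ} (hD : D ∈ ({-1, -2, -3, -7, -11} : Set ℤ))
    (hdeg : Module.finrank ℚ K = 2) {r : K} (hrD : r ^ 2 = (D : K)) {x y : K} (hy : y ≠ 0)
    (h : y ^ 2 = x * (x + 1) * (x + 4)) : x ^ 2 = 4 := by
  classical
  have hD0 : D < 0 := by rcases hD with rfl | rfl | rfl | rfl | rfl <;> norm_num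
  have hr := r_not_rat hD0 hrD
  have hr0 : r ≠ 0 := fun h0 => hr 0 (by rw [h0]; simp)
  obtain ⟨σ, hσ⟩ := exists_conj hdeg hrD hr
  have hW := baseE (K := K)
  have dec := decomp hdeg hr
  have σrat : ∀ q : ℚ, σ (q : K) = q := fun q => by simp
  have σinv : ∀ z, σ (σ z) = z := by
    intro z
    obtain ⟨a, b, rfl⟩ := dec z
    simp only [map_add, map_mul, σrat, hσ, map_neg, neg_neg]
  have σfix : ∀ z, σ z = z → ∃ q : ℚ, z = q := by
    intro z hz
    obtain ⟨a, b, rfl⟩ := dec z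
    simp only [map_add, map_mul, σrat, hσ] at hz
    have : ((0 : ℚ) : K) + ((2 * b : ℚ) : K) * r = 0 := by push_cast; linear_combination -hz
    have hb := indep hr this
    have : b = 0 := by linarith
    subst this
    exact ⟨a, by simp⟩
  have σanti : ∀ z, σ z = -z → ∃ q : ℚ, z = q * r := by
    intro z hz
    obtain ⟨a, b, rfl⟩ := dec z
    simp only [map_add, map_mul, σrat, hσ] at hz
    have : (a : K) = 0 := by
      have : 2 * (a : K) = 0 := by linear_combination hz
      simpa using this
    exact ⟨b, by rw [this]; ring⟩
  have h' : y ^ 2 = x * (x - -1) * (x - 4 * -1) := by rw [h]; ring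
  set P : ((EC (-1)).baseChange K : WeierstrassCurve K).toAffine.Point :=
    Affine.Point.some x y (hW.ns h') with hP
  let s : ((EC (-1)).baseChange K : WeierstrassCurve K).toAffine.Point →+
    ((EC (-1)).baseChange K : WeierstrassCurve K).toAffine.Point :=
      Affine.Point.map (W' := EC (-1)) (S := ℚ) σ
  have s_some : ∀ (x y : K) h, ∃ h', s (Affine.Point.some x y h) = Affine.Point.some (σ x) (σ y) h' :=
    fun x y h => ⟨_, rfl⟩
  have s_s : ∀ Q, s (s Q) = Q := by
    rintro (_ | ⟨a, b, hab⟩)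
    · rfl
    · obtain ⟨h1, e1⟩ := s_some a b hab
      obtain ⟨h2, e2⟩ := s_some (σ a) (σ b) h1
      rw [e1, e2]
      simp only [σinv]
  -- the anti-invariant part
  have hR : (2 : ℕ) • (P - s P) = 0 := by
    have anti : s (P - s P) = -(P - s P) := by rw [map_sub, s_s, neg_sub]
    rcases hR : P - s P with _ | ⟨u, v, huv⟩
    · exact nsmul_zero _
    · apply hW.dbl_zero
      rw [hR] at anti
      obtain ⟨h1, e1⟩ := s_some u v huv
      rw [e1, Affine.Point.neg_some, Affine.Point.some.injEq, hW.negY] at anti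
      obtain ⟨a, rfl⟩ := σfix u anti.1
      obtain ⟨b, rfl⟩ := σanti v anti.2
      have e := hW.eq.1 huv.1
      have e' : b ^ 2 * D = a * (a + 1) * (a + 4) := by
        have : (b : K) ^ 2 * D = a * (a + 1) * (a + 4) := by
          rw [← hrD]; linear_combination e
        exact_mod_cast this
      have := pos_two_torsion (n := -D) (X := -(-D) * a * (-1) * (-1)) (Y := D ^ 2 * b)
        (by rcases hD with rfl | rfl | rfl | rfl | rfl <;> simp)
        (by push_cast; linear_combination (D : ℚ) ^ 3 * e')
      have hDQ : (D : ℚ) ≠ 0 := by exact_mod_cast hD0.ne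
      have hb : b = 0 := by simpa [hDQ] using this
      rw [hb]; simp
  have fix : s ((2 : ℕ) • P) = (2 : ℕ) • P := by
    rw [nsmul_sub, sub_eq_zero] at hR
    rw [map_nsmul, ← hR]
  obtain ⟨x₃, y₃, h₃, e, e1, -⟩ := hW.dbl (hW.ns h') hy
  obtain ⟨q1, q2, q3⟩ := hW.dbl_sq e
  rw [← hP] at e
  rw [e] at fix
  obtain ⟨h1, e2⟩ := s_some x₃ y₃ h₃
  rw [e2, Affine.Point.some.injEq] at fix
  obtain ⟨a, rfl⟩ := σfix x₃ fix.1
  obtain ⟨b, rfl⟩ := σfix y₃ fix.2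
  have e3 := hW.eq.1 h₃.1
  have e4 : b ^ 2 = a * (a + 1) * (a + 4) := by
    have : (b : K) ^ 2 = a * (a + 1) * (a + 4) := by linear_combination e3
    exact_mod_cast this
  have key : ∀ m : ℤ, (m = 2 ∨ m = 3 ∨ m = 12) → ¬ IsSquare ((m : ℚ) : K) := by
    intro m hm hsq
    refine not_sq hm (rat_sq hdeg hD0 hrD ?_ hsq)
    rcases hm with rfl | rfl | rfl <;> norm_num
  have a0 : a = 0 := by
    rcases neg_points e4 with h | h | h | h
    · exact h
    · exfalso
      refine key 3 (by simp) ?_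
      convert q3 using 1
      rw [h]; push_cast; ring
    · exfalso
      refine key 12 (by simp) ?_
      obtain ⟨w, hw⟩ := q1.mul q2
      exact ⟨w, by rw [← hw, h]; push_cast; ring⟩
    · exfalso
      rcases sq_eq_sq_iff_eq_or_eq_neg.1 (h.trans (show (4 : ℚ) = 2 ^ 2 by norm_num)) with h | h
      · refine key 2 (by simp) ?_
        convert q1 using 1
        rw [h]; push_cast; ring
      · refine key 2 (by simp) ?_
        convert q3 using 1
        rw [h]; push_cast; ring
  rw [a0, Rat.cast_zero, zero_mul] at e1
  have := pow_eq_zero_iff (two_ne_zero) |>.1 e1.symm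
  linear_combination this
end quad
end Aux

theorem no_solution_order2_eq_order3
    (D : ℤ) (hD : D ∈ ({-1, -2, -3, -7, -11} : Set ℤ))
    (K : Type*) [Field K] [NumberField K]
    (hdeg : Module.finrank ℚ K = 2)
    (hK : ∃ r : K, r ^ 2 = (D : K))
    (s t d : 𝓞 K) (hs : s ≠ 0) (ht : t ≠ 0) (hd : d ≠ 0) (hst : s ^ 2 ≠ t ^ 2) :
    ¬ ∃ a b c : 𝓞 K,
        d * s ^ 2 = a ^ 3 * (a + 2 * b) * c ^ 2 ∧
        d * t ^ 2 = b ^ 3 * (b + 2 * a) * c ^ 2 := by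
  rintro ⟨a, b, c, h1, h2⟩
  obtain ⟨r, hr⟩ := hK
  have n1 : d * s ^ 2 ≠ 0 := mul_ne_zero hd (pow_ne_zero _ hs)
  have n2 : d * t ^ 2 ≠ 0 := mul_ne_zero hd (pow_ne_zero _ ht)
  have ha : a ≠ 0 := by rintro rfl; apply n1; rw [h1]; ring
  have hb : b ≠ 0 := by rintro rfl; apply n2; rw [h2]; ring
  have hc : c ≠ 0 := by rintro rfl; apply n1; rw [h1]; ring
  have inj : ∀ {z : 𝓞 K}, z ≠ 0 → (algebraMap (𝓞 K) K z) ≠ 0 := fun hz =>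
    (map_ne_zero_iff _ (FaithfulSMul.algebraMap_injective (𝓞 K) K)).2 hz
  have k1 := congrArg (algebraMap (𝓞 K) K) h1
  have k2 := congrArg (algebraMap (𝓞 K) K) h2
  simp only [map_mul, map_pow, map_add, map_ofNat] at k1 k2
  have hab : a ^ 2 = b ^ 2 := by
    apply FaithfulSMul.algebraMap_injective (𝓞 K) K
    rw [map_pow, map_pow]
    have ha' := inj ha
    have hb' := inj hb
    have hc' := inj hc
    have hs' := inj hs
    have ht' := inj ht
    have hd' := inj hd
    generalize algebraMap (𝓞 K) K a = a at *
    generalize algebraMap (𝓞 K) K b = b at *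
    generalize algebraMap (𝓞 K) K c = c at *
    generalize algebraMap (𝓞 K) K d = d at *
    generalize algebraMap (𝓞 K) K s = s at *
    generalize algebraMap (𝓞 K) K t = t at *
    have := Aux.K_points hD hdeg hr (x := 2 * a / b) (y := 2 * d * s * t / (a * b ^ 3 * c ^ 2))
      (by
        have : (2 : K) ≠ 0 := two_ne_zero
        positivity)
      (by
        field_simp
        linear_combination 2 * (d * t ^ 2) * k1 + 2 * (a ^ 3 * (a + 2 * b) * c ^ 2) * k2)
    field_simp at this
    linear_combination this / 4
  apply hst
  apply mul_left_cancel₀ hd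
  rw [h1, h2]
  have hab' := mul_eq_zero.1 (show (a - b) * (a + b) = 0 by linear_combination hab)
  rcases hab' with h | h
  · rw [sub_eq_zero.1 h]
  · rw [eq_neg_of_add_eq_zero_left h]; ring
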